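/- For a primary Gaussian prime π = a + bi, the quartic residue symbol satisfies ((1+i)/π)₄ = i^((a − 1 − b − b²)/4). -/

import Mathlib

open Zsqrtd

local notation "ℤ[i]" => GaussianInt

/-- The imaginary unit `i` in `ℤ[i]`. -/
def gi : ℤ[i] := Zsqrtd.sqrtd

/-- `α` is primary if `α ≡ 1 (mod 2(1+i))`. -/
def IsPrimary (α : ℤ[i]) : Prop := 2 * (1 + gi) ∣ α - 1
open scoped Classical in
/-- The quartic residue symbol `(α/π)₄`: the unique power of `i` congruent to
`α ^ ((Nπ - 1)/4)` modulo `π`, where `Nπ` is the cardinality of `ℤ[i]/(π)`. -/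
noncomputable def quartic (α π : ℤ[i]) : ℤ[i] :=
  if h : ∃ k : Fin 4,
      π ∣ α ^ ((Nat.card (ℤ[i] ⧸ Ideal.span {π}) - 1) / 4) - gi ^ (k : ℕ)
  then gi ^ ((h.choose : Fin 4) : ℕ) else 0

/-- `i` as a unit of `ℤ[i]`. -/
def giUnit : (GaussianInt)ˣ := ⟨gi, -gi, by decide, by decide⟩


theorem gi_sq : gi ^ 2 = -1 := by decide

theorem primary_facts (π : ℤ[i]) (hp : IsPrimary π) :
    π.im % 2 = 0 ∧ (π.re + π.im) % 4 = 1 := by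
  obtain ⟨z, hz⟩ := hp
  have h1 := congrArg Zsqrtd.re hz
  have h2 := congrArg Zsqrtd.im hz
  simp [gi] at h1 h2
  constructor <;> omega

theorem prim4 {R : Type*} [CommRing R] [IsDomain R] (h2 : (2 : R) ≠ 0) {x : R}
    (hx : x ^ 2 = -1) : IsPrimitiveRoot x 4 := by
  have h4 : x ^ (2 ^ (1 + 1)) = 1 := by
    have : x ^ (2 ^ (1 + 1)) = (x ^ 2) ^ 2 := by ring
    rw [this, hx]; ring
  have hn : ¬ x ^ (2 ^ 1) = 1 := by
    intro h
    apply h2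
    rw [pow_one, hx] at h
    linear_combination -h
  have := orderOf_eq_prime_pow hn h4
  have h' := IsPrimitiveRoot.orderOf x
  rw [this] at h'
  simpa using h'

theorem two_ne_zero_gi : (2 : ℤ[i]) ≠ 0 := by decide

theorem prim_gi : IsPrimitiveRoot gi 4 := prim4 two_ne_zero_gi gi_sq

/-- the power of `i` with integer exponent. -/
def U (k : ℤ) : ℤ[i] := ((giUnit ^ k : (GaussianInt)ˣ) : ℤ[i])

theorem U_add (j k : ℤ) : U (j + k) = U j * U k := by
  simp [U, zpow_add]

theorem U_natCast (k : ℕ) : U k = gi ^ k := by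
  simp [U]; rfl

theorem U_eq_iff_map {R : Type*} [CommRing R] [IsDomain R] (h2 : (2 : R) ≠ 0)
    (φ : ℤ[i] →+* R) (j k : ℤ) : φ (U j) = φ (U k) ↔ (4 : ℤ) ∣ j - k := by
  have hgi : (φ gi) ^ 2 = -1 := by rw [← map_pow, gi_sq]; simp
  have hp : IsPrimitiveRoot (Units.map (φ : ℤ[i] →* R) giUnit) 4 := by
    rw [← IsPrimitiveRoot.coe_units_iff]
    exact prim4 h2 hgi
  have := hp.zpow_eq_one_iff_dvd (j - k)
  rw [Nat.cast_ofNat] at this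
  rw [← this, zpow_sub, mul_inv_eq_one, ← map_zpow, ← map_zpow, Units.ext_iff]
  rfl

theorem U_eq_iff (j k : ℤ) : U j = U k ↔ (4 : ℤ) ∣ j - k :=
  U_eq_iff_map two_ne_zero_gi (RingHom.id _) j k

theorem U_mul_nat (k : ℤ) (n : ℕ) : U (k * n) = U k ^ n := by
  simp [U, zpow_mul]

theorem U_two : U 2 = -1 := by
  have := U_natCast 2
  rw [gi_sq] at this
  exact_mod_cast this

theorem card_quot (π : ℤ[i]) :
    (Nat.card (ℤ[i] ⧸ Ideal.span {π}) : ℤ) = π.re ^ 2 + π.im ^ 2 := by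
  let e : ℤ[i] ≃ₗ[ℤ] (Fin 2 → ℤ) :=
    { toFun := fun z => ![z.re, z.im]
      invFun := fun v => ⟨v 0, v 1⟩
      left_inv := fun z => rfl
      right_inv := fun v => by ext i; fin_cases i <;> rfl
      map_add' := fun x y => by ext i; fin_cases i <;> rfl
      map_smul' := fun c x => by ext i; fin_cases i <;> simp }
  let b : Module.Basis (Fin 2) ℤ ℤ[i] := Module.Basis.ofEquivFun e
  have : Module.Free ℤ ℤ[i] := Module.Free.of_basis b
  have : Module.Finite ℤ ℤ[i] := Module.Finite.of_basis b
  have h := Ideal.absNorm_span_singleton π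
  rw [Ideal.absNorm_apply, Submodule.cardQuot_apply] at h
  have hr : ∀ z : ℤ[i], ∀ j, b.repr z j = ![z.re, z.im] j := fun z j => by
    rw [← Module.Basis.equivFun_apply]
    simp only [b, Module.Basis.equivFun_ofEquivFun]
    rfl
  have b0 : b 0 = ⟨1, 0⟩ := by
    simp [b, Module.Basis.coe_ofEquivFun]
    rfl
  have b1 : b 1 = ⟨0, 1⟩ := by
    simp [b, Module.Basis.coe_ofEquivFun]
    rfl
  have hn : Algebra.norm ℤ π = π.re ^ 2 + π.im ^ 2 := by
    rw [Algebra.norm_eq_matrix_det b, Matrix.det_fin_two]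
    simp only [Algebra.leftMulMatrix_eq_repr_mul, hr, b0, b1]
    simp
    ring
  rw [hn] at h
  have h' : (Nat.card (ℤ[i] ⧸ Ideal.span {π}) : ℤ) = ((π.re ^ 2 + π.im ^ 2).natAbs : ℤ) := by
    exact_mod_cast h
  rw [h', Int.natAbs_of_nonneg (by positivity)]

theorem exists_char {F : Type*} [Field F] [Fintype F] (red : ℤ[i] →+* F)
    (m : ℕ) (hN : Fintype.card F = 4 * m + 1) :
    ∃ χ : MulChar F ℤ[i], χ ^ 4 = 1 ∧ χ ≠ 1 ∧ χ ^ 2 ≠ 1 ∧ ∀ x, red (χ x) = x ^ m := by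
  classical
  obtain ⟨γ, hγ⟩ := IsCyclic.exists_generator (α := Fˣ)
  have hcard : Fintype.card Fˣ = 4 * m := by rw [Fintype.card_units]; omega
  have hm : 0 < m := by
    have := Fintype.card_pos (α := Fˣ)
    omega
  have hord : orderOf γ = 4 * m := by
    rw [orderOf_eq_card_of_forall_mem_zpowers hγ, Nat.card_eq_fintype_card, hcard]
  have hgi : (red gi) ^ 2 = -1 := by rw [← map_pow, gi_sq]; simp
  have hc4 : ((γ : F) ^ m) ^ 4 = 1 := by
    rw [← pow_mul, mul_comm, ← hord, ← Units.val_pow_eq_pow_val, pow_orderOf_eq_one]; rfl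
  have hc2 : ((γ : F) ^ m) ^ 2 ≠ 1 := by
    rw [← pow_mul, ← Units.val_pow_eq_pow_val]
    intro h
    have h' : γ ^ (m * 2) = 1 := Units.ext h
    have := Nat.le_of_dvd (by omega) (orderOf_dvd_of_pow_eq_one h')
    omega
  have hc : ((γ : F) ^ m) ^ 2 = -1 := by
    have : (((γ : F) ^ m) ^ 2 - 1) * (((γ : F) ^ m) ^ 2 + 1) = 0 := by
      linear_combination hc4
    rcases mul_eq_zero.mp this with h | h
    · exact absurd (sub_eq_zero.mp h) hc2
    · linear_combination h
  obtain ⟨μ, hμ2, hμ⟩ : ∃ μ : (ℤ[i])ˣ, (μ : ℤ[i]) ^ 2 = -1 ∧ red μ = (γ : F) ^ m := by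
    have : ((γ : F) ^ m - red gi) * ((γ : F) ^ m + red gi) = 0 := by
      linear_combination hc - hgi
    rcases mul_eq_zero.mp this with h | h
    · exact ⟨giUnit, gi_sq, (sub_eq_zero.mp h).symm⟩
    · refine ⟨-giUnit, ?_, ?_⟩
      · rw [Units.val_neg, neg_sq]; exact gi_sq
      · rw [Units.val_neg, map_neg]
        change - red gi = _
        linear_combination -h
  have hμ4 : (μ : ℤ[i]) ^ 4 = 1 := by
    have : (μ : ℤ[i]) ^ 4 = ((μ : ℤ[i]) ^ 2) ^ 2 := by ring
    rw [this, hμ2]; ring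
  have hroot : μ ∈ rootsOfUnity (Fintype.card Fˣ) ℤ[i] := by
    rw [mem_rootsOfUnity, hcard, pow_mul]
    have : μ ^ 4 = 1 := Units.ext hμ4
    rw [this, one_pow]
  let χ := MulChar.ofRootOfUnity hroot hγ
  have hχ : χ γ = μ := MulChar.ofRootOfUnity_spec hroot hγ
  refine ⟨χ, ?_, ?_, ?_, ?_⟩
  · rw [MulChar.eq_iff hγ, MulChar.pow_apply_coe, hχ, hμ4, MulChar.one_apply_coe]
  · rw [Ne, MulChar.eq_iff hγ, hχ, MulChar.one_apply_coe]
    intro h; rw [h] at hμ2; exact absurd hμ2 (by decide)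
  · rw [Ne, MulChar.eq_iff hγ, MulChar.pow_apply_coe, hχ, hμ2, MulChar.one_apply_coe]
    decide
  · intro x
    by_cases hx : x = 0
    · rw [hx, MulChar.map_zero, map_zero, zero_pow hm.ne']
    · have hx' := hγ (Units.mk0 x hx)
      rw [← mem_powers_iff_mem_zpowers] at hx'
      obtain ⟨k, hk⟩ := hx'
      have hk' : (γ : F) ^ k = x := by
        have := congrArg Units.val hk
        simpa using this
      rw [← hk', map_pow, hχ, map_pow, hμ, ← pow_mul, ← pow_mul, mul_comm]

theorem char_val {F : Type*} [Field F] [Fintype F] (χ : MulChar F ℤ[i]) (h4 : χ ^ 4 = 1)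
    {x : F} (hx : x ≠ 0) : ∃ k : ℕ, k < 4 ∧ χ x = U k := by
  obtain ⟨k, hk, h⟩ := MulChar.exists_apply_eq_pow h4 prim_gi hx
  exact ⟨k, hk, by rw [h, U_natCast]⟩

theorem sum_pow_mul {F : Type*} [Field F] [Fintype F] (m : ℕ) (hm : 0 < m)
    (hN : Fintype.card F = 4 * m + 1) : ∑ x : F, x ^ m * (1 - x) ^ m = 0 := by
  classical
  let P : Polynomial F := Polynomial.X ^ m * (1 - Polynomial.X) ^ m
  have hdeg : P.natDegree < 2 * m + 1 := by
    have : P.natDegree ≤ m + m * 1 := by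
      refine Polynomial.natDegree_mul_le_of_le (Polynomial.natDegree_X_pow_le m) ?_
      refine Polynomial.natDegree_pow_le_of_le m ?_
      refine (Polynomial.natDegree_sub_le _ _).trans ?_
      simp
    omega
  have h : ∀ x : F, x ^ m * (1 - x) ^ m = ∑ i ∈ Finset.range (2 * m + 1), P.coeff i * x ^ i := by
    intro x
    rw [← Polynomial.eval_eq_sum_range' hdeg]
    simp [P]
  simp_rw [h]
  rw [Finset.sum_comm]
  refine Finset.sum_eq_zero fun i hi => ?_
  rw [← Finset.mul_sum, FiniteField.sum_pow_lt_card_sub_one, mul_zero]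
  have := Finset.mem_range.mp hi
  omega

theorem U_neg_one_sq {F : Type*} [Field F] [Fintype F] (χ : MulChar F ℤ[i]) :
    (χ ^ 2) (-1) = 1 := by
  rw [MulChar.pow_apply' _ two_ne_zero, ← map_pow]
  simp

theorem norm_jacobi {F : Type*} [Field F] [Fintype F] (χ : MulChar F ℤ[i])
    (h1 : χ ≠ 1) (h2 : χ ^ 2 ≠ 1) : (jacobiSum χ χ).norm = (Fintype.card F : ℤ) := by
  classical
  have hinj := GaussianInt.toComplex_injective
  let χ' := χ.ringHomComp GaussianInt.toComplex
  have h1' : χ' ≠ 1 := (MulChar.ringHomComp_ne_one_iff hinj).mpr h1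
  have h2' : χ' * χ' ≠ 1 := by
    rw [← sq]
    change (χ.ringHomComp GaussianInt.toComplex) ^ 2 ≠ 1
    rw [MulChar.ringHomComp_pow]
    exact (MulChar.ringHomComp_ne_one_iff hinj).mpr h2
  have hc : ringChar ℂ ≠ ringChar F := by
    rw [ringChar.eq_zero]
    exact (CharP.ringChar_ne_zero_of_finite F).symm
  have h := jacobiSum_mul_jacobiSum_inv hc h1' h1' h2'
  have hs : jacobiSum χ'⁻¹ χ'⁻¹ = starRingEnd ℂ (jacobiSum χ' χ') := by
    rw [← jacobiSum_ringHomComp]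
    rw [← MulChar.star_eq_inv]
    rfl
  rw [hs, Complex.mul_conj, jacobiSum_ringHomComp] at h
  have := GaussianInt.intCast_complex_norm (jacobiSum χ χ)
  rw [h] at this
  exact_mod_cast this

theorem jacobi_sq {F : Type*} [Field F] [Fintype F] (π : ℤ[i]) (him : π.im % 2 = 0)
    (hre : π.re % 2 = 1) (red : ℤ[i] →+* F) (hker : ∀ x, red x = 0 → π ∣ x)
    (m : ℕ) (hm : 0 < m) (hN : Fintype.card F = 4 * m + 1) (hNπ : (Fintype.card F : ℤ) = π.norm)
    (χ : MulChar F ℤ[i])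
    (h4 : χ ^ 4 = 1) (h1 : χ ≠ 1) (h2 : χ ^ 2 ≠ 1) (hχ : ∀ x, red (χ x) = x ^ m) :
    jacobiSum χ χ ^ 2 = π ^ 2 := by
  classical
  have hd : π ∣ jacobiSum χ χ := by
    apply hker
    rw [jacobiSum, map_sum]
    simp_rw [map_mul, hχ]
    exact sum_pow_mul m hm hN
  obtain ⟨z, hz⟩ := hd
  have hn := norm_jacobi χ h1 h2
  rw [hz, Zsqrtd.norm_mul, hNπ] at hn
  have hz1 : z.norm = 1 := by
    have : π.norm ≠ 0 := by rw [← hNπ, hN]; positivity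
    exact mul_left_cancel₀ this (by rw [hn, mul_one])
  obtain ⟨w, -, hw⟩ := exists_jacobiSum_eq_neg_one_add (n := 4) (by norm_num) h4 h4
    ⟨m, by omega⟩ prim_gi
  have hg : (gi - 1) ^ 2 = ⟨0, -2⟩ := by decide
  rw [hg, hz] at hw
  have e1 := congrArg Zsqrtd.im hw
  simp at e1
  rw [Zsqrtd.norm_def] at hz1
  have hzim : z.im % 2 = 0 := by
    have h : (π.re * z.im + π.im * z.re) % 2 = 0 := by rw [e1]; omega
    obtain ⟨s, hs⟩ : (2 : ℤ) ∣ π.im := by omega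
    obtain ⟨t, ht⟩ : (2 : ℤ) ∣ π.re - 1 := by omega
    have : π.re = 2 * t + 1 := by omega
    rw [this, hs] at h
    ring_nf at h
    have : z.im + (t * z.im + s * z.re) * 2 = z.im + t * z.im * 2 + s * z.re * 2 := by ring
    omega
  have hzim0 : z.im = 0 := by
    have l1 : z.im < 2 := by nlinarith [mul_self_nonneg z.re]
    have l2 : -2 < z.im := by nlinarith [mul_self_nonneg z.re]
    omega
  have : z ^ 2 = 1 := by
    ext
    · simp [sq, hzim0] at *; linarith
    · simp [sq, hzim0]
  rw [hz, mul_pow, this, mul_one]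

theorem ringHomComp_ne_one' {F : Type*} [Field F] [Fintype F] (χ : MulChar F ℤ[i])
    (h4 : χ ^ 4 = 1) (h1 : χ ≠ 1) {R : Type*} [Field R] (h2 : (2 : R) ≠ 0) (φ : ℤ[i] →+* R) :
    χ.ringHomComp φ ≠ 1 := by
  intro h
  apply h1
  refine MulChar.ext fun x => ?_
  obtain ⟨k, -, hk⟩ := char_val χ h4 x.ne_zero
  have h' : φ (χ x) = 1 := by
    have := congrArg (fun f : MulChar F R => f x) h
    simpa using this
  have hU0 : U 0 = 1 := by simp [U]
  have : φ (U k) = φ (U 0) := by rw [← hk, h', hU0, map_one]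
  rw [U_eq_iff_map h2] at this
  rw [hk, MulChar.one_apply_coe, ← hU0, U_eq_iff]
  exact this

theorem gauss_four {F : Type*} [Field F] [Fintype F] {R : Type*} [Field R]
    (χ : MulChar F R) (h4 : χ ^ 4 = 1) (h2 : χ ^ 2 ≠ 1) (ψ : AddChar F R)
    (hψ : ψ.IsPrimitive) :
    gaussSum χ ψ ^ 4 = Fintype.card F * jacobiSum χ χ ^ 2 := by
  classical
  have e1 := jacobiSum_mul_nontrivial (χ := χ) (φ := χ) (by rwa [← sq]) ψ
  have hq : (χ ^ 2).IsQuadratic := by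
    intro x
    by_cases hx : x = 0
    · left; rw [hx, MulChar.map_zero]
    · right
      have : ((χ ^ 2) x) ^ 2 = 1 := by
        rw [← MulChar.pow_apply' _ two_ne_zero, ← pow_mul, h4,
          MulChar.one_apply (isUnit_iff_ne_zero.mpr hx)]
      have h0 : ((χ ^ 2) x - 1) * ((χ ^ 2) x + 1) = 0 := by linear_combination this
      rcases mul_eq_zero.mp h0 with h | h
      · left; linear_combination h
      · right; linear_combination h
  have e2 := gaussSum_sq h2 hq hψ
  have e3 : (χ ^ 2) (-1) = 1 := by
    rw [MulChar.pow_apply' _ two_ne_zero, ← map_pow]; simp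
  rw [← sq] at e1
  rw [e3, one_mul] at e2
  rw [← e2]
  linear_combination (-(gaussSum χ ψ ^ 2) - gaussSum (χ ^ 2) ψ * jacobiSum χ χ) * e1

theorem gauss_main {F : Type} [Field F] [Fintype F] (π : ℤ[i]) (χ : MulChar F ℤ[i])
    (h4 : χ ^ 4 = 1) (h1 : χ ≠ 1) (h2 : χ ^ 2 ≠ 1) (hJ : jacobiSum χ χ ^ 2 = π ^ 2)
    (q : ℕ) (hq : q.Prime) (hq2 : q ≠ 2) (hqN : ¬ q ∣ Fintype.card F) :
    ∃ (R : Type) (_ : Field R) (_ : CharP R q) (φ : ℤ[i] →+* R),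
      (q % 4 = 1 → φ (χ q) * (φ (Fintype.card F * π ^ 2)) ^ ((q - 1) / 4) = 1) ∧
      (q % 4 = 3 → (φ (Fintype.card F * π ^ 2)) ^ ((q + 1) / 4) =
        φ (χ (-q)) * Fintype.card F) := by
  classical
  have : Fact q.Prime := ⟨hq⟩
  let K := AlgebraicClosure (ZMod q)
  have hK : CharP K q := inferInstance
  obtain ⟨n, hp, hc⟩ := FiniteField.card F (ringChar F)
  have hch : ringChar K ≠ ringChar F := by
    intro h
    rw [ringChar.eq K q] at h
    apply hqN
    rw [hc, ← h]
    exact dvd_pow_self _ n.ne_zero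
  let Ψ := AddChar.FiniteField.primitiveChar F K hch
  let R := CyclotomicField Ψ.n K
  let ψ : AddChar F R := Ψ.char
  have hψ : ψ.IsPrimitive := Ψ.prim
  have hR : CharP R q := charP_of_injective_algebraMap (algebraMap K R).injective q
  obtain ⟨I, hI⟩ := IsAlgClosed.exists_pow_nat_eq (-1 : K) (n := 2) (by norm_num)
  let φ : ℤ[i] →+* R := Zsqrtd.lift ⟨algebraMap K R I, by
    rw [← sq, ← map_pow, hI]; simp⟩
  have hR2 : (2 : R) ≠ 0 := by
    intro h
    have : ((2 : ℕ) : R) = 0 := by exact_mod_cast h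
    rw [CharP.cast_eq_zero_iff R q] at this
    exact hq2 ((Nat.prime_dvd_prime_iff_eq hq Nat.prime_two).mp this)
  have hRN : (Fintype.card F : R) ≠ 0 := by
    intro h
    rw [CharP.cast_eq_zero_iff R q] at h
    exact hqN h
  have hqF : (q : F) ≠ 0 := by
    intro h
    rw [CharP.cast_eq_zero_iff F (ringChar F)] at h
    apply hch
    rw [ringChar.eq K q]
    exact ((Nat.prime_dvd_prime_iff_eq hp hq).mp h).symm
  refine ⟨R, inferInstance, hR, φ, ?_⟩
  let χ' := χ.ringHomComp φ
  have hχ'v : ∀ x, χ' x = φ (χ x) := fun x => rfl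
  have h4' : χ' ^ 4 = 1 := by
    change (χ.ringHomComp φ) ^ 4 = 1
    rw [MulChar.ringHomComp_pow, h4, MulChar.ringHomComp_one]
  have h1' : χ' ≠ 1 := ringHomComp_ne_one' χ h4 h1 hR2 φ
  have h2' : χ' ^ 2 ≠ 1 := by
    change (χ.ringHomComp φ) ^ 2 ≠ 1
    rw [MulChar.ringHomComp_pow]
    exact ringHomComp_ne_one' (χ ^ 2) (by rw [← pow_mul, mul_comm, pow_mul, h4, one_pow]) h2 hR2 φ
  have hg4 : gaussSum χ' ψ ^ 4 = φ (Fintype.card F * π ^ 2) := by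
    rw [gauss_four χ' h4' h2' ψ hψ, ← hJ]
    simp only [χ', jacobiSum_ringHomComp, map_mul, map_pow, map_natCast]
  have hg0 : gaussSum χ' ψ ≠ 0 := gaussSum_ne_zero_of_nontrivial hRN h1' hψ
  have hfrob : gaussSum χ' ψ ^ q = gaussSum (χ' ^ q) (ψ.mulShift (q : F)) := by
    rw [gaussSum_frob, AddChar.pow_mulShift]
  let u : Fˣ := Units.mk0 (q : F) hqF
  have hu : (u : F) = q := rfl
  rw [← hg4]
  constructor
  · intro hq1
    have e : χ' ^ q = χ' := by
      obtain ⟨k, hk⟩ : ∃ k, q = 4 * k + 1 := ⟨q / 4, by omega⟩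
      have : χ' ^ (4 * k + 1) = χ' := by rw [pow_add, pow_mul, h4', one_pow, one_mul, pow_one]
      rwa [← hk] at this
    have := gaussSum_mulShift χ' ψ u
    rw [hu] at this
    rw [e] at hfrob
    rw [← hfrob] at this
    rw [← pow_mul, Nat.mul_div_cancel' (by omega)]
    have hq' : q - 1 + 1 = q := by omega
    apply mul_right_cancel₀ hg0
    rw [one_mul, mul_assoc, ← pow_succ, hq', ← hχ'v]
    exact this
  · intro hq3
    have e : χ' ^ q = χ'⁻¹ := by
      rw [eq_inv_iff_mul_eq_one, ← pow_succ]
      have : q + 1 = 4 * ((q + 1) / 4) := by omega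
      rw [this, pow_mul, h4', one_pow]
    have s1 := gaussSum_mulShift χ'⁻¹ ψ u
    have s2 := gaussSum_mulShift χ'⁻¹ ψ (-1)
    have s3 := gaussSum_mul_gaussSum_eq_card h1' hψ
    rw [hu] at s1
    rw [e] at hfrob
    rw [← hfrob] at s1
    rw [AddChar.inv_mulShift] at s3
    rw [Units.val_neg, Units.val_one] at s2
    have s4 : χ' (q : F) * χ'⁻¹ (q : F) = 1 := by
      rw [MulChar.inv_apply', ← map_mul, mul_inv_cancel₀ hqF, map_one]
    have s5 : χ'⁻¹ (-1 : F) = χ' (-1) := by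
      rw [MulChar.inv_apply', inv_neg, inv_one]
    rw [← pow_mul, Nat.mul_div_cancel' (by omega), ← hχ'v, neg_eq_neg_one_mul, map_mul, ← s5,
      pow_succ, ← s3]
    set g := gaussSum χ' ψ
    linear_combination (χ' q * g) * s1 - (χ' q * g) * s2 - g ^ q * g * s4

theorem U_zero : U 0 = 1 := by simp [U]

theorem gi_mul_self : gi * gi = -1 := by decide

theorem val_of_map {F : Type*} [Field F] [Fintype F] (χ : MulChar F ℤ[i])
    (h4 : χ ^ 4 = 1) {R : Type*} [Field R] (h2 : (2 : R) ≠ 0) (φ : ℤ[i] →+* R) {x : F}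
    (hx : x ≠ 0) (j : ℤ) (h : φ (χ x) = φ (U j)) : χ x = U j := by
  obtain ⟨k, -, hk⟩ := char_val χ h4 hx
  rw [hk] at h ⊢
  rw [U_eq_iff_map h2] at h
  rwa [U_eq_iff]

theorem decomp (π : ℤ[i]) : π = (π.re : ℤ[i]) + (π.im : ℤ[i]) * gi := by
  ext <;> simp [gi]

/-- prime step for divisors of `a`. -/
theorem prime_dvd_re {F : Type} [Field F] [Fintype F] (π : ℤ[i]) (χ : MulChar F ℤ[i])
    (h4 : χ ^ 4 = 1) (h1 : χ ≠ 1) (h2 : χ ^ 2 ≠ 1) (hJ : jacobiSum χ χ ^ 2 = π ^ 2)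
    (hN : (Fintype.card F : ℤ) = π.re ^ 2 + π.im ^ 2)
    (q : ℕ) (hq : q.Prime) (hq2 : q ≠ 2) (hqN : ¬ q ∣ Fintype.card F) (hqF : (q : F) ≠ 0)
    (hd : (q : ℤ) ∣ π.re) :
    (q % 4 = 1 → χ (q : F) = U (2 * (((q : ℤ) - 1) / 4))) ∧
    (q % 4 = 3 → χ (-q : F) = U (2 * ((-(q : ℤ) - 1) / 4))) := by
  obtain ⟨R, _, _, φ, H1, H3⟩ := gauss_main π χ h4 h1 h2 hJ q hq hq2 hqN
  have : Fact q.Prime := ⟨hq⟩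
  have hR2 : (2 : R) ≠ 0 := by
    intro h
    have : ((2 : ℕ) : R) = 0 := by exact_mod_cast h
    rw [CharP.cast_eq_zero_iff R q] at this
    exact hq2 ((Nat.prime_dvd_prime_iff_eq hq Nat.prime_two).mp this)
  have ha : (π.re : R) = 0 := (CharP.intCast_eq_zero_iff R q _).mpr hd
  have hNR : (Fintype.card F : R) = (π.im : R) ^ 2 := by
    have := congrArg (Int.cast : ℤ → R) hN
    push_cast at this
    rw [this, ha]; ring
  have hN0 : (Fintype.card F : R) ≠ 0 := by
    rw [Ne, CharP.cast_eq_zero_iff R q]; exact hqN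
  have hb0 : (π.im : R) ≠ 0 := by
    intro h; rw [hNR, h] at hN0; simp at hN0
  have hbq : (π.im : R) ^ q = π.im := by
    rw [← frobenius_def, map_intCast]
  have hι : φ gi ^ 2 = -1 := by rw [← map_pow, gi_sq]; simp
  have hπ : φ π = π.im * φ gi := by
    conv_lhs => rw [decomp π]
    simp [ha]
  have hmain : φ (Fintype.card F * π ^ 2) = (-1) * (π.im : R) ^ 4 := by
    rw [map_mul, map_pow, hπ, map_natCast, hNR]
    linear_combination (π.im : R) ^ 4 * hι
  have hU : ∀ k : ℕ, φ (U (2 * k)) = (-1) ^ k := by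
    intro k; rw [U_mul_nat, U_two]; simp
  rw [hmain, mul_pow, ← pow_mul] at H1 H3
  constructor
  · intro hq1
    have h := H1 hq1
    rw [Nat.mul_div_cancel' (by omega)] at h
    have hb1 : (π.im : R) ^ (q - 1) = 1 := by
      apply mul_right_cancel₀ hb0
      rw [← pow_succ, Nat.sub_add_cancel hq.one_le, hbq, one_mul]
    rw [hb1, mul_one] at h
    apply val_of_map χ h4 hR2 φ hqF
    have e : ((q : ℤ) - 1) / 4 = ((q - 1) / 4 : ℕ) := by omega
    rw [e, hU]
    rcases neg_one_pow_eq_or R ((q - 1) / 4) with h' | h'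
    · rw [h'] at h ⊢
      linear_combination h
    · rw [h'] at h ⊢
      linear_combination -h
  · intro hq3
    have h := H3 hq3
    rw [Nat.mul_div_cancel' (by omega), pow_succ, hbq, hNR] at h
    apply val_of_map χ h4 hR2 φ (neg_ne_zero.mpr hqF)
    have e : (4 : ℤ) ∣ (2 * ((-(q : ℤ) - 1) / 4)) - (2 * ((q + 1) / 4 : ℕ)) := by omega
    rw [(U_eq_iff _ _).mpr e, hU]
    have : (π.im : R) ^ 2 ≠ 0 := pow_ne_zero _ hb0
    apply mul_right_cancel₀ this
    rw [← h]; ring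

/-- prime step for divisors of `a + b`. -/
theorem prime_dvd_add {F : Type} [Field F] [Fintype F] (π : ℤ[i]) (χ : MulChar F ℤ[i])
    (h4 : χ ^ 4 = 1) (h1 : χ ≠ 1) (h2 : χ ^ 2 ≠ 1) (hJ : jacobiSum χ χ ^ 2 = π ^ 2)
    (hN : (Fintype.card F : ℤ) = π.re ^ 2 + π.im ^ 2)
    (q : ℕ) (hq : q.Prime) (hq2 : q ≠ 2) (hqN : ¬ q ∣ Fintype.card F) (hqF : (q : F) ≠ 0)
    (hd : (q : ℤ) ∣ π.re + π.im) :
    (q % 4 = 1 → χ (q : F) = U (-1 * (((q : ℤ) - 1) / 4))) ∧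
    (q % 4 = 3 → χ (-q : F) = U (-1 * ((-(q : ℤ) - 1) / 4))) := by
  obtain ⟨R, _, _, φ, H1, H3⟩ := gauss_main π χ h4 h1 h2 hJ q hq hq2 hqN
  have : Fact q.Prime := ⟨hq⟩
  have hR2 : (2 : R) ≠ 0 := by
    intro h
    have : ((2 : ℕ) : R) = 0 := by exact_mod_cast h
    rw [CharP.cast_eq_zero_iff R q] at this
    exact hq2 ((Nat.prime_dvd_prime_iff_eq hq Nat.prime_two).mp this)
  have hb : (π.im : R) = -π.re := by
    have := (CharP.intCast_eq_zero_iff R q _).mpr hd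
    push_cast at this
    linear_combination this
  have hNR : (Fintype.card F : R) = 2 * (π.re : R) ^ 2 := by
    have := congrArg (Int.cast : ℤ → R) hN
    push_cast at this
    rw [this, hb]; ring
  have hN0 : (Fintype.card F : R) ≠ 0 := by
    rw [Ne, CharP.cast_eq_zero_iff R q]; exact hqN
  have ha0 : (π.re : R) ≠ 0 := by
    intro h; rw [hNR, h] at hN0; simp at hN0
  have haq : (π.re : R) ^ q = π.re := by
    rw [← frobenius_def, map_intCast]
  have hι : φ gi ^ 2 = -1 := by rw [← map_pow, gi_sq]; simp
  have hι4 : φ gi ^ 4 = 1 := by linear_combination (φ gi ^ 2 - 1) * hι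
  have hπ : φ π = π.re * (1 - φ gi) := by
    conv_lhs => rw [decomp π]
    simp [hb]; ring
  have hmain : φ (Fintype.card F * π ^ 2) = φ gi * (π.re * (1 + φ gi) : R) ^ 4 := by
    rw [map_mul, map_pow, hπ, map_natCast, hNR]
    linear_combination (- φ gi ^ 3 - 4 * φ gi ^ 2 - 5 * φ gi + 2) * (π.re : R) ^ 4 * hι
  have hU : ∀ k : ℕ, φ (U k) = φ gi ^ k := by
    intro k; rw [U_natCast, map_pow]
  have h1ι : (1 + φ gi) ≠ 0 := by
    intro h
    apply hR2
    linear_combination (1 - φ gi) * h + hι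
  have hfr : (1 + φ gi) ^ q = 1 + φ gi ^ q := by
    rw [← frobenius_def, map_add, map_one, frobenius_def]
  rw [hmain, mul_pow, ← pow_mul] at H1 H3
  constructor
  · intro hq1
    have h := H1 hq1
    have hιq : φ gi ^ q = φ gi := by
      obtain ⟨k, hk⟩ : ∃ k, q = 4 * k + 1 := ⟨q / 4, by omega⟩
      have : φ gi ^ (4 * k + 1) = φ gi := by
        rw [pow_add, pow_mul, hι4, one_pow, one_mul, pow_one]
      rwa [← hk] at this
    rw [Nat.mul_div_cancel' (by omega)] at h
    have hb1 : (π.re * (1 + φ gi) : R) ^ (q - 1) = 1 := by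
      apply mul_right_cancel₀ (mul_ne_zero ha0 h1ι)
      rw [← pow_succ, Nat.sub_add_cancel hq.one_le, mul_pow, haq, one_mul, hfr, hιq]
    rw [hb1, mul_one] at h
    apply val_of_map χ h4 hR2 φ hqF
    have e : -1 * (((q : ℤ) - 1) / 4) = -((q - 1) / 4 : ℕ) := by omega
    rw [e]
    have h0 : φ (U (-((q - 1) / 4 : ℕ))) * φ gi ^ ((q - 1) / 4) = 1 := by
      rw [← hU, ← map_mul, ← U_add, neg_add_cancel, U_zero, map_one]
    have hne : φ gi ^ ((q - 1) / 4) ≠ 0 := right_ne_zero_of_mul_eq_one h0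
    exact mul_right_cancel₀ hne (h.trans h0.symm)
  · intro hq3
    have h := H3 hq3
    have hιq : φ gi ^ q = - φ gi := by
      obtain ⟨k, hk⟩ : ∃ k, q = 4 * k + 3 := ⟨q / 4, by omega⟩
      have : φ gi ^ (4 * k + 3) = -φ gi := by
        rw [pow_add, pow_mul, hι4, one_pow, one_mul]
        linear_combination φ gi * hι
      rwa [← hk] at this
    rw [Nat.mul_div_cancel' (by omega), pow_succ, mul_pow, haq, hfr, hιq, hNR] at h
    apply val_of_map χ h4 hR2 φ (neg_ne_zero.mpr hqF)
    have e : -1 * ((-(q : ℤ) - 1) / 4) = ((q + 1) / 4 : ℕ) := by omega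
    rw [e, hU]
    have : 2 * (π.re : R) ^ 2 ≠ 0 := mul_ne_zero hR2 (pow_ne_zero _ ha0)
    apply mul_right_cancel₀ this
    rw [← h]
    linear_combination -φ gi ^ ((q + 1) / 4) * (π.re : R) ^ 2 * hι

theorem mult_step {F : Type} [Field F] [Fintype F] (χ : MulChar F ℤ[i]) (e D : ℤ)
    (hP : ∀ q : ℕ, q.Prime → q ≠ 2 → (q : ℤ) ∣ D →
      (q % 4 = 1 → χ (q : F) = U (e * (((q : ℤ) - 1) / 4))) ∧
      (q % 4 = 3 → χ (-q : F) = U (e * ((-(q : ℤ) - 1) / 4)))) :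
    ∀ n : ℕ, (n : ℤ) ∣ D → ∀ d : ℤ, d.natAbs = n → d % 4 = 1 →
      χ (d : F) = U (e * ((d - 1) / 4)) := by
  intro n
  induction n using induction_on_primes with
  | zero => intro _ d h1 h2; omega
  | one =>
    intro _ d h1 h2
    have : d = 1 := by omega
    subst this
    simp [U_zero]
  | prime_mul p a hp ih =>
    intro hD d h1 h2
    have hpa : (p * a) % 2 = 1 := by omega
    have hp2 : p % 2 = 1 := by
      rcases Nat.mod_two_eq_zero_or_one p with h | h
      · rw [Nat.mul_mod, h] at hpa; simp at hpa
      · exact h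
    have ha2 : a % 2 = 1 := by
      rcases Nat.mod_two_eq_zero_or_one a with h | h
      · rw [Nat.mul_mod, h] at hpa; simp at hpa
      · exact h
    push_cast at hD
    obtain ⟨H1, H3⟩ := hP p hp (by omega) (dvd_of_mul_right_dvd hD)
    obtain ⟨d1, hd1, hd1', hχ1⟩ : ∃ d1 : ℤ, d1.natAbs = p ∧ d1 % 4 = 1 ∧
        χ (d1 : F) = U (e * ((d1 - 1) / 4)) := by
      have : p % 4 = 1 ∨ p % 4 = 3 := by omega
      rcases this with h | h
      · exact ⟨p, by omega, by omega, by simpa using H1 h⟩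
      · exact ⟨-p, by omega, by omega, by simpa using H3 h⟩
    obtain ⟨d2, hd2, hd2'⟩ : ∃ d2 : ℤ, d2.natAbs = a ∧ d2 % 4 = 1 := by
      have : a % 4 = 1 ∨ a % 4 = 3 := by omega
      rcases this with h | h
      · exact ⟨a, by omega, by omega⟩
      · exact ⟨-a, by omega, by omega⟩
    have hχ2 := ih (dvd_of_mul_left_dvd hD) d2 hd2 hd2'
    obtain ⟨x, hx⟩ : ∃ x, d1 = 4 * x + 1 := ⟨d1 / 4, by omega⟩
    obtain ⟨y, hy⟩ : ∃ y, d2 = 4 * y + 1 := ⟨d2 / 4, by omega⟩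
    have hxy : d1 * d2 = 4 * (4 * (x * y) + x + y) + 1 := by rw [hx, hy]; ring
    have hdd : d = d1 * d2 := by
      have : d.natAbs = (d1 * d2).natAbs := by rw [h1, Int.natAbs_mul, hd1, hd2]
      rcases Int.natAbs_eq_natAbs_iff.mp this with h | h
      · exact h
      · omega
    have e1 : (d - 1) / 4 = 4 * (x * y) + x + y := by omega
    have e2 : (d1 - 1) / 4 = x := by omega
    have e3 : (d2 - 1) / 4 = y := by omega
    rw [e1, hdd, Int.cast_mul, map_mul, hχ1, hχ2, ← U_add, U_eq_iff, e2, e3]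
    exact ⟨-(e * x * y), by ring⟩

theorem mk_eq_zero (π x : ℤ[i]) : Ideal.Quotient.mk (Ideal.span {π}) x = 0 ↔ π ∣ x := by
  rw [Ideal.Quotient.eq_zero_iff_mem, Ideal.mem_span_singleton]

theorem quartic_eq (α π : ℤ[i]) (hπ : Prime π) (h2 : ¬ π ∣ 2) (k : ℤ)
    (h : π ∣ α ^ ((Nat.card (ℤ[i] ⧸ Ideal.span {π}) - 1) / 4) - U k) :
    quartic α π = U k := by
  have hprime : (Ideal.span {π}).IsPrime := (Ideal.span_singleton_prime hπ.ne_zero).mpr hπ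
  have : IsDomain (ℤ[i] ⧸ Ideal.span {π}) := Ideal.Quotient.isDomain _
  have h2' : (2 : ℤ[i] ⧸ Ideal.span {π}) ≠ 0 := by
    intro h
    apply h2
    rw [← mk_eq_zero, map_ofNat, h]
  have hex : ∃ j : Fin 4,
      π ∣ α ^ ((Nat.card (ℤ[i] ⧸ Ideal.span {π}) - 1) / 4) - gi ^ (j : ℕ) := by
    refine ⟨⟨(k % 4).toNat, by omega⟩, ?_⟩
    rw [← U_natCast]
    have : U (((k % 4).toNat : ℕ) : ℤ) = U k := by
      rw [U_eq_iff]; omega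
    rwa [this]
  unfold quartic
  rw [dif_pos hex]
  have hs := hex.choose_spec
  rw [← U_natCast] at hs ⊢
  rw [U_eq_iff, ← U_eq_iff_map h2' (Ideal.Quotient.mk (Ideal.span {π})), ← sub_eq_zero, ← map_sub,
    mk_eq_zero]
  have := dvd_sub h hs
  simpa using this

theorem no_common (π : ℤ[i]) (hπ : Prime π) (hre : π.re ≠ 0) (him : π.im ≠ 0) (q : ℕ)
    (hq : q.Prime) (h1 : (q : ℤ) ∣ π.re) (h2 : (q : ℤ) ∣ π.im) : False := by
  have hd : ((q : ℤ) : ℤ[i]) ∣ π := (Zsqrtd.intCast_dvd _ _).mpr ⟨h1, h2⟩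
  obtain ⟨w, hw⟩ := hd
  have hr := congrArg Zsqrtd.re hw
  have hi := congrArg Zsqrtd.im hw
  rw [Zsqrtd.re_smul] at hr
  rw [Zsqrtd.im_smul] at hi
  rcases hπ.irreducible.isUnit_or_isUnit hw with h | h
  · rw [← Zsqrtd.norm_eq_one_iff] at h
    simp [Zsqrtd.norm_def] at h
    rw [Int.natAbs_mul, Int.natAbs_natCast] at h
    exact hq.one_lt.ne' (Nat.eq_one_of_mul_eq_one_right h)
  · rw [← Zsqrtd.norm_eq_one_iff] at h
    have hw1 : w.re ≠ 0 := by intro h; rw [h] at hr; simp at hr; exact hre hr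
    have hw2 : w.im ≠ 0 := by intro h; rw [h] at hi; simp at hi; exact him hi
    have e1 : 0 < w.re * w.re := mul_self_pos.mpr hw1
    have e2 : 0 < w.im * w.im := mul_self_pos.mpr hw2
    rw [Zsqrtd.norm_def] at h
    have : w.re * w.re - -1 * w.im * w.im = w.re * w.re + w.im * w.im := by ring
    omega

theorem split_case (π : ℤ[i]) (hπ : Prime π) (hp : IsPrimary π) (him : π.im ≠ 0) :
    quartic (1 + gi) π = U ((π.re - 1 - π.im - π.im ^ 2) / 4) := by
  classical
  obtain ⟨hb, hab⟩ := primary_facts π hp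
  have hprime : (Ideal.span {π}).IsPrime := (Ideal.span_singleton_prime hπ.ne_zero).mpr hπ
  have hmax : (Ideal.span {π}).IsMaximal :=
    hprime.isMaximal (by simpa using hπ.ne_zero)
  have hre : π.re ≠ 0 := by omega
  have hcard := card_quot π
  have hsq : 0 < π.re ^ 2 := by positivity
  have hfin : Finite (ℤ[i] ⧸ Ideal.span {π}) := by
    apply Nat.finite_of_card_ne_zero
    have := sq_nonneg π.im
    omega
  let F := ℤ[i] ⧸ Ideal.span {π}
  letI : Field F := Ideal.Quotient.field _
  letI : Fintype F := Fintype.ofFinite F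
  rw [Nat.card_eq_fintype_card] at hcard
  change (Fintype.card F : ℤ) = _ at hcard
  let red : ℤ[i] →+* F := Ideal.Quotient.mk (Ideal.span {π})
  have hker : ∀ x, red x = 0 ↔ π ∣ x := mk_eq_zero π
  obtain ⟨s, hs⟩ : ∃ s, π.re = 2 * s + 1 := ⟨π.re / 2, by omega⟩
  obtain ⟨t, ht⟩ : ∃ t, π.im = 2 * t := ⟨π.im / 2, by omega⟩
  have hN4 : (Fintype.card F : ℤ) = 4 * (s * (s + 1) + t * t) + 1 := by
    rw [hcard, hs, ht]; ring
  obtain ⟨m, hN⟩ : ∃ m, Fintype.card F = 4 * m + 1 := ⟨Fintype.card F / 4, by omega⟩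
  have hm : 0 < m := by
    have := Fintype.one_lt_card (α := F)
    omega
  obtain ⟨χ, h4, h1, h2, hχ⟩ := exists_char red m hN
  have hJ := jacobi_sq π hb (by omega) red (fun x => (hker x).mp) m hm hN
    (by rw [hcard, Zsqrtd.norm_def]; ring) χ h4 h1 h2 hχ
  have hF2 : (2 : F) ≠ 0 := by
    intro h
    have h0 : ((Fintype.card F : ℕ) : F) = 0 := FiniteField.cast_card_eq_zero F
    rw [hN] at h0
    push_cast at h0
    have : (1 : F) = 0 := by linear_combination h0 - 2 * m * h
    exact one_ne_zero this
  have hqF : ∀ q : ℕ, q.Prime → ¬ q ∣ Fintype.card F → (q : F) ≠ 0 := by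
    intro q hq hqN h
    apply hqN
    have h0 : ((Fintype.card F : ℕ) : F) = 0 := FiniteField.cast_card_eq_zero F
    rw [CharP.cast_eq_zero_iff F (ringChar F)] at h0
    rwa [CharP.ringChar_of_prime_eq_zero hq h] at h0
  have hA := mult_step χ 2 π.re (fun q hq hq2 hd => by
    have hqN : ¬ q ∣ Fintype.card F := by
      intro h
      have h' : (q : ℤ) ∣ π.re ^ 2 + π.im ^ 2 := by rw [← hcard]; exact_mod_cast h
      have h'' : (q : ℤ) ∣ π.im ^ 2 := (dvd_add_right (dvd_pow hd two_ne_zero)).mp h'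
      exact no_common π hπ hre him q hq hd ((Nat.prime_iff_prime_int.mp hq).dvd_of_dvd_pow h'')
    exact prime_dvd_re π χ h4 h1 h2 hJ hcard q hq hq2 hqN (hqF q hq hqN) hd)
  have hB := mult_step χ (-1) (π.re + π.im) (fun q hq hq2 hd => by
    have hqN : ¬ q ∣ Fintype.card F := by
      intro h
      have hqp := Nat.prime_iff_prime_int.mp hq
      have h' : (q : ℤ) ∣ π.re ^ 2 + π.im ^ 2 := by rw [← hcard]; exact_mod_cast h
      have h'' : (q : ℤ) ∣ 2 * π.re ^ 2 := by
        have : 2 * π.re ^ 2 = (π.re ^ 2 + π.im ^ 2) + (π.re + π.im) * (π.re - π.im) := by ring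
        rw [this]
        exact dvd_add h' (dvd_mul_of_dvd_left hd _)
      rcases hqp.dvd_or_dvd h'' with h | h
      · have : q ∣ 2 := by exact_mod_cast h
        exact hq2 ((Nat.prime_dvd_prime_iff_eq hq Nat.prime_two).mp this)
      · have hda := hqp.dvd_of_dvd_pow h
        exact no_common π hπ hre him q hq hda ((dvd_add_right hda).mp hd)
    exact prime_dvd_add π χ h4 h1 h2 hJ hcard q hq hq2 hqN (hqF q hq hqN) hd)
  have hab' := hB _ (Int.natAbs_dvd.mpr dvd_rfl) (π.re + π.im) rfl hab
  have hrel : (π.re : F) * red (1 + gi) = ((π.re + π.im : ℤ) : F) := by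
    rw [← map_intCast red, ← map_intCast red, ← map_mul, ← sub_eq_zero, ← map_sub, hker]
    refine ⟨gi, ?_⟩
    conv_rhs => rw [decomp π]
    push_cast
    linear_combination -(π.im : ℤ[i]) * gi_mul_self
  have hx : red (1 + gi) ≠ 0 := by
    intro h
    apply hF2
    have : (2 : F) = red ((1 + gi) * (1 - gi)) := by
      have : (1 + gi) * (1 - gi) = 2 := by decide
      rw [this, map_ofNat]
    rw [this, map_mul, h, zero_mul]
  obtain ⟨j, -, hj⟩ := char_val χ h4 hx
  have hrel' := congrArg χ hrel
  rw [map_mul, hj, hab'] at hrel'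
  have hfinal : (4 : ℤ) ∣ j - (π.re - 1 - π.im - π.im ^ 2) / 4 := by
    have hcase : π.im % 4 = 0 ∨ π.im % 4 = 2 := by omega
    rcases hcase with h | h
    · have ha := hA _ (Int.natAbs_dvd.mpr dvd_rfl) π.re rfl (by omega)
      rw [ha, ← U_add, U_eq_iff] at hrel'
      obtain ⟨r, hr⟩ : ∃ r, π.im = 4 * r := ⟨π.im / 4, by omega⟩
      have : π.im ^ 2 = 16 * (r * r) := by rw [hr]; ring
      omega
    · have ha := hA _ (Int.natAbs_dvd.mpr dvd_rfl) (-π.re) (by simp) (by omega)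
      obtain ⟨r, hr⟩ : ∃ r, π.im = 4 * r + 2 := ⟨π.im / 4, by omega⟩
      have hm1 : χ (-1) = U 2 := by
        apply val_of_map χ h4 hF2 red (neg_ne_zero.mpr one_ne_zero)
        rw [hχ, U_two, map_neg, map_one]
        apply Odd.neg_one_pow
        rw [← Int.odd_coe_nat]
        have ht' : t = 2 * r + 1 := by omega
        have : (m : ℤ) = s * (s + 1) + t * t := by omega
        rw [this]
        apply Even.add_odd (Int.even_mul_succ_self s)
        have : Odd t := ⟨r, ht'⟩
        exact this.mul this
      have ha2 : χ (π.re : F) = U (2 + 2 * ((-π.re - 1) / 4)) := by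
        have : (π.re : F) = (-1) * ((-π.re : ℤ) : F) := by push_cast; ring
        rw [this, map_mul, ha, hm1, ← U_add]
      rw [ha2, ← U_add, U_eq_iff] at hrel'
      have : π.im ^ 2 = 16 * (r * r + r) + 4 := by rw [hr]; ring
      omega
  rw [← (U_eq_iff _ _).mpr hfinal, ← hj]
  rw [hj]
  apply quartic_eq _ _ hπ
  · rw [← hker, map_ofNat]; exact hF2
  · rw [← hker, map_sub, ← hj, hχ, Nat.card_eq_fintype_card]
    have : (Fintype.card F - 1) / 4 = m := by omega
    change red ((1 + gi) ^ ((Fintype.card F - 1) / 4)) - _ = 0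
    rw [this, map_pow, sub_self]

theorem inert_case (π : ℤ[i]) (hπ : Prime π) (hp : IsPrimary π) (him : π.im = 0) :
    quartic (1 + gi) π = U ((π.re - 1 - π.im - π.im ^ 2) / 4) := by
  classical
  obtain ⟨hb, hab⟩ := primary_facts π hp
  have hprime : (Ideal.span {π}).IsPrime := (Ideal.span_singleton_prime hπ.ne_zero).mpr hπ
  have hmax : (Ideal.span {π}).IsMaximal :=
    hprime.isMaximal (by simpa using hπ.ne_zero)
  have hπa : π = (π.re : ℤ[i]) := by
    conv_lhs => rw [decomp π]
    simp [him]
  have hqa : Prime ((π.re.natAbs : ℕ) : ℤ[i]) := by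
    rcases Int.natAbs_eq π.re with h | h
    · have : ((π.re.natAbs : ℕ) : ℤ[i]) = π := by
        conv_rhs => rw [hπa, h]
        simp
      rwa [this]
    · have : ((π.re.natAbs : ℕ) : ℤ[i]) = -π := by
        conv_rhs => rw [hπa, h]
        simp
      rw [this]; exact hπ.neg
  obtain ⟨q, hq⟩ : ∃ q, q = π.re.natAbs := ⟨_, rfl⟩
  rw [← hq] at hqa
  have hqp : q.Prime := by
    rw [Nat.prime_iff_prime_int]
    have hd : ∀ x : ℤ, (q : ℤ) ∣ x ↔ ((q : ℕ) : ℤ[i]) ∣ (x : ℤ[i]) := by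
      intro x
      rw [← Zsqrtd.intCast_dvd_intCast (d := -1)]
      simp
    refine ⟨?_, ?_, ?_⟩
    · intro h
      apply hqa.ne_zero
      have : q = 0 := by exact_mod_cast h
      simp [this]
    · intro h
      apply hqa.not_isUnit
      have : q = 1 := by
        rw [Int.isUnit_iff] at h; omega
      simp [this]
    · intro x y h
      rw [hd, Int.cast_mul] at h
      rw [hd, hd]
      exact hqa.dvd_or_dvd h
  have : Fact q.Prime := ⟨hqp⟩
  have hq3 : q % 4 = 3 := (GaussianInt.prime_iff_mod_four_eq_three_of_nat_prime q).mp hqa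
  have haq : π.re = -q := by omega
  have hcard := card_quot π
  rw [him, haq] at hcard
  have hcard' : Nat.card (ℤ[i] ⧸ Ideal.span {π}) = q ^ 2 := by
    have : (Nat.card (ℤ[i] ⧸ Ideal.span {π}) : ℤ) = (q : ℤ) ^ 2 := by rw [hcard]; ring
    exact_mod_cast this
  let F := ℤ[i] ⧸ Ideal.span {π}
  letI : Field F := Ideal.Quotient.field _
  let red : ℤ[i] →+* F := Ideal.Quotient.mk (Ideal.span {π})
  have hker : ∀ x, red x = 0 ↔ π ∣ x := mk_eq_zero π
  have hqF : (q : F) = 0 := by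
    rw [← map_natCast red, hker, hπa, haq]
    simp
  have hchar : CharP F q := ringChar.of_eq (CharP.ringChar_of_prime_eq_zero hqp hqF)
  have hF2 : (2 : F) ≠ 0 := by
    intro h
    have : ((2 : ℕ) : F) = 0 := by exact_mod_cast h
    rw [CharP.cast_eq_zero_iff F q] at this
    have := (Nat.prime_dvd_prime_iff_eq hqp Nat.prime_two).mp this
    omega
  obtain ⟨k, hk⟩ : ∃ k, q + 1 = 4 * k := ⟨(q + 1) / 4, by omega⟩
  have hexp : (π.re - 1 - π.im - π.im ^ 2) / 4 = -1 * (k : ℤ) := by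
    rw [him, haq]; omega
  have hexp2 : (q ^ 2 - 1) / 4 = (q - 1) * k := by
    have : q ^ 2 - 1 = 4 * ((q - 1) * k) := by
      have h := Nat.sq_sub_sq q 1
      rw [one_pow] at h
      rw [h, hk]; ring
    omega
  rw [hexp]
  apply quartic_eq _ _ hπ
  · rw [← hker, map_ofNat]; exact hF2
  · rw [hcard', hexp2, ← hker, map_sub, sub_eq_zero, U_mul_nat, map_pow, map_pow, pow_mul]
    congr 1
    have hU1 : U (-1) = -gi := by
      simp [U]; rfl
    have hι : red gi ^ 2 = -1 := by rw [← map_pow, gi_sq]; simp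
    have hι4 : red gi ^ 4 = 1 := by linear_combination (red gi ^ 2 - 1) * hι
    have hιq : red gi ^ q = - red gi := by
      obtain ⟨l, hl⟩ : ∃ l, q = 4 * l + 3 := ⟨q / 4, by omega⟩
      have : red gi ^ (4 * l + 3) = -red gi := by
        rw [pow_add, pow_mul, hι4, one_pow, one_mul]
        linear_combination red gi * hι
      rwa [← hl] at this
    have h1ι : (1 + red gi) ≠ 0 := by
      intro h
      apply hF2
      linear_combination (1 - red gi) * h + hι
    have hfr : (1 + red gi) ^ q = 1 + red gi ^ q := by
      rw [← frobenius_def, map_add, map_one, frobenius_def]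
    rw [hU1, map_neg, map_add, map_one]
    apply mul_right_cancel₀ h1ι
    rw [← pow_succ, Nat.sub_add_cancel hqp.one_le, hfr, hιq]
    linear_combination hι

/-- For a primary Gaussian prime `π = a + bi`, one has
`((1+i)/π)₄ = i^((a - 1 - b - b²)/4)`. -/
theorem quartic_one_add_i (π : ℤ[i]) (hπ : Prime π) (hp : IsPrimary π) :
    quartic (1 + gi) π =
      ((giUnit ^ ((π.re - 1 - π.im - π.im ^ 2) / 4) : (GaussianInt)ˣ) : ℤ[i]) := by
  by_cases him : π.im = 0
  · exact inert_case π hπ hp him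
  · exact split_case π hπ hp him
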